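/- (Calibration error bound.) Let ℓ be a bounded proper scoring loss; let Q and Q* be PMFs on X × Y with Q*_X(x) > 0 for all x ∈ X; let h*(x) := Q*(·|x); and assume the saddle-point inequality R_Q(h*,ℓ) ≤ R_{Q*}(h*,ℓ). Then the calibration error of h* under Q is bounded by the difference of expected generalized entropies: CE_Q(h*,ℓ) ≤ B_{Q*}(ℓ) − B_Q(ℓ). -/

import Mathlib

open Finset
open scoped Classical

noncomputable section

/-- The standard probability simplex over a finite type `Y`. -/
def simplex (Y : Type*) [Fintype Y] : Set (Y → ℝ) :=
  {p | (∀ y, 0 ≤ p y) ∧ ∑ y, p y = 1}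

variable {X Y : Type*}

/-- Expected loss `L(p,q) = Σ_y p(y)·ℓ(y,q)`. -/
def expLoss [Fintype Y] (ℓ : Y → (Y → ℝ) → ℝ) (p q : Y → ℝ) : ℝ :=
  ∑ y, p y * ℓ y q

/-- A scoring loss is bounded by `M` if `0 ≤ ℓ(y,q) ≤ M` for all `y` and `q ∈ Δ^Y`. -/
def IsBoundedLoss [Fintype Y] (ℓ : Y → (Y → ℝ) → ℝ) (M : ℝ) : Prop :=
  ∀ y : Y, ∀ q ∈ simplex Y, 0 ≤ ℓ y q ∧ ℓ y q ≤ M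

/-- A scoring loss is proper if `L(p,p) ≤ L(p,q)` for all `p, q ∈ Δ^Y`. -/
def IsProper [Fintype Y] (ℓ : Y → (Y → ℝ) → ℝ) : Prop :=
  ∀ p ∈ simplex Y, ∀ q ∈ simplex Y, expLoss ℓ p p ≤ expLoss ℓ p q

/-- Generalized entropy `H_ℓ(p) = inf_{q ∈ Δ^Y} L(p,q)`. -/
def genEnt [Fintype Y] (ℓ : Y → (Y → ℝ) → ℝ) (p : Y → ℝ) : ℝ :=
  sInf ((fun q => expLoss ℓ p q) '' simplex Y)

/-- Bregman divergence `d_ℓ(p,q) = L(p,q) − H_ℓ(p)`. -/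
def breg [Fintype Y] (ℓ : Y → (Y → ℝ) → ℝ) (p q : Y → ℝ) : ℝ :=
  expLoss ℓ p q - genEnt ℓ p

/-- A probability mass function on `X × Y`. -/
def IsPMF [Fintype X] [Fintype Y] (P : X × Y → ℝ) : Prop :=
  (∀ z, 0 ≤ P z) ∧ ∑ z, P z = 1

/-- The `X`-marginal `P_X(x) = Σ_y P(x,y)`. -/
def margX [Fintype Y] (P : X × Y → ℝ) (x : X) : ℝ := ∑ y, P (x, y)

/-- The conditional distribution `P(·|x)`. -/
def condY [Fintype Y] (P : X × Y → ℝ) (x : X) : Y → ℝ :=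
  fun y => P (x, y) / margX P x

/-- Risk `R_P(h,ℓ) = Σ_{x,y} P(x,y)·ℓ(y,h(x))`. -/
def risk [Fintype X] [Fintype Y] (P : X × Y → ℝ) (h : X → Y → ℝ)
    (ℓ : Y → (Y → ℝ) → ℝ) : ℝ :=
  ∑ z : X × Y, P z * ℓ z.2 (h z.1)

/-- The weight `w_ν = Σ_{x : h(x)=ν} P_X(x)`. -/
def weight [Fintype X] [Fintype Y] (P : X × Y → ℝ) (h : X → Y → ℝ) (ν : Y → ℝ) : ℝ :=
  ∑ x ∈ univ.filter (fun x => h x = ν), margX P x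

/-- The conditional outcome distribution `P(·|h=ν)`. -/
def condOut [Fintype X] [Fintype Y] (P : X × Y → ℝ) (h : X → Y → ℝ) (ν : Y → ℝ) : Y → ℝ :=
  fun y => (∑ x ∈ univ.filter (fun x => h x = ν), P (x, y)) / weight P h ν

/-- `h` is canonically calibrated under `P` if `P(·|h=ν) = ν` whenever `w_ν > 0`. -/
def Calibrated [Fintype X] [Fintype Y] (P : X × Y → ℝ) (h : X → Y → ℝ) : Prop :=
  ∀ ν : Y → ℝ, 0 < weight P h ν → condOut P h ν = ν

/-- Calibration error `CE_P(h,ℓ) = Σ_{ν : w_ν>0} w_ν · d_ℓ(P(·|h=ν), ν)`,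
the sum ranging over the (finitely many) values in the range of `h`. -/
def CE [Fintype X] [Fintype Y] (P : X × Y → ℝ) (h : X → Y → ℝ)
    (ℓ : Y → (Y → ℝ) → ℝ) : ℝ :=
  ∑ ν ∈ (univ.image h).filter (fun ν => 0 < weight P h ν),
    weight P h ν * breg ℓ (condOut P h ν) ν

/-- Refinement `RF_P(h,ℓ) = Σ_{ν : w_ν>0} w_ν · H_ℓ(P(·|h=ν))`. -/
def RF [Fintype X] [Fintype Y] (P : X × Y → ℝ) (h : X → Y → ℝ)
    (ℓ : Y → (Y → ℝ) → ℝ) : ℝ :=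
  ∑ ν ∈ (univ.image h).filter (fun ν => 0 < weight P h ν),
    weight P h ν * genEnt ℓ (condOut P h ν)

/-- Bayes refinement `B_P(ℓ) = Σ_{x : P_X(x)>0} P_X(x) · H_ℓ(P(·|x))`. -/
def BayesRF [Fintype X] [Fintype Y] (P : X × Y → ℝ) (ℓ : Y → (Y → ℝ) → ℝ) : ℝ :=
  ∑ x ∈ univ.filter (fun x => 0 < margX P x), margX P x * genEnt ℓ (condY P x)

/-- The optimal (Bayes) value `V(Q) = inf_{h : X → Δ^Y} R_Q(h,ℓ)`. -/
def mdlV [Fintype X] [Fintype Y] (ℓ : Y → (Y → ℝ) → ℝ) (Q : X × Y → ℝ) : ℝ :=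
  sInf {r : ℝ | ∃ h : X → Y → ℝ, (∀ x, h x ∈ simplex Y) ∧ r = risk Q h ℓ}

theorem genEnt_eq_expLoss_self [Fintype Y] {ℓ : Y → (Y → ℝ) → ℝ} (hp : IsProper ℓ)
    {p : Y → ℝ} (hps : p ∈ simplex Y) : genEnt ℓ p = expLoss ℓ p p := by
  refine IsLeast.csInf_eq ⟨⟨p, hps, rfl⟩, ?_⟩
  rintro _ ⟨q, hq, rfl⟩
  exact hp p hps q hq

theorem margX_nonneg [Fintype X] [Fintype Y] {P : X × Y → ℝ} (hP : IsPMF P) (x : X) :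
    0 ≤ margX P x :=
  sum_nonneg fun y _ => hP.1 (x, y)

theorem condY_mem_simplex [Fintype X] [Fintype Y] {P : X × Y → ℝ} (hP : IsPMF P) {x : X}
    (hx : 0 < margX P x) : condY P x ∈ simplex Y := by
  refine ⟨fun y => div_nonneg (hP.1 _) hx.le, ?_⟩
  simp only [condY, ← sum_div]
  exact div_self hx.ne'

theorem margX_mul_expLoss_condY [Fintype Y] (ℓ : Y → (Y → ℝ) → ℝ) {P : X × Y → ℝ} {x : X}
    (hx : 0 < margX P x) (q : Y → ℝ) :
    margX P x * expLoss ℓ (condY P x) q = ∑ y, P (x, y) * ℓ y q := by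
  simp only [expLoss, condY, mul_sum]
  refine sum_congr rfl fun y _ => ?_
  field_simp

theorem weight_mul_expLoss_condOut [Fintype X] [Fintype Y] (ℓ : Y → (Y → ℝ) → ℝ)
    {P : X × Y → ℝ} {h : X → Y → ℝ} {ν : Y → ℝ} (hν : 0 < weight P h ν) (q : Y → ℝ) :
    weight P h ν * expLoss ℓ (condOut P h ν) q =
      ∑ x ∈ univ.filter (fun x => h x = ν), ∑ y, P (x, y) * ℓ y q := by
  rw [sum_comm]
  simp only [expLoss, condOut, mul_sum, ← sum_mul]
  refine sum_congr rfl fun y _ => ?_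
  field_simp

theorem condOut_mem_simplex [Fintype X] [Fintype Y] {P : X × Y → ℝ} (hP : IsPMF P)
    {h : X → Y → ℝ} {ν : Y → ℝ} (hν : 0 < weight P h ν) : condOut P h ν ∈ simplex Y := by
  refine ⟨fun y => div_nonneg (sum_nonneg fun x _ => hP.1 _) hν.le, ?_⟩
  simp only [condOut, ← sum_div]
  rw [sum_comm]
  exact div_self hν.ne'

/-- On each fibre, the Bayes-optimal loss is at most the loss of any fixed prediction. -/
theorem margX_mul_genEnt_le [Fintype X] [Fintype Y] {ℓ : Y → (Y → ℝ) → ℝ} (hp : IsProper ℓ)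
    {P : X × Y → ℝ} (hP : IsPMF P) (x : X) {q : Y → ℝ} (hq : q ∈ simplex Y) :
    margX P x * genEnt ℓ (condY P x) ≤ ∑ y, P (x, y) * ℓ y q := by
  rcases (margX_nonneg hP x).eq_or_lt with h0 | hx
  · have hz : ∀ y, P (x, y) = 0 := fun y =>
      (sum_eq_zero_iff_of_nonneg fun y _ => hP.1 (x, y)).1 h0.symm y (mem_univ y)
    simp [← h0, hz]
  · have hc := condY_mem_simplex hP hx
    rw [← margX_mul_expLoss_condY ℓ hx, genEnt_eq_expLoss_self hp hc]
    exact mul_le_mul_of_nonneg_left (hp _ hc _ hq) hx.le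

theorem BayesRF_eq_sum [Fintype X] [Fintype Y] (ℓ : Y → (Y → ℝ) → ℝ) {P : X × Y → ℝ}
    (hP : IsPMF P) : BayesRF P ℓ = ∑ x, margX P x * genEnt ℓ (condY P x) := by
  refine sum_filter_of_ne fun x _ hx => ?_
  exact (margX_nonneg hP x).lt_of_ne' (left_ne_zero_of_mul hx)

/-- The calibration error is at most the excess risk over the Bayes refinement. -/
theorem CE_le_risk_sub_BayesRF [Fintype X] [Fintype Y] {ℓ : Y → (Y → ℝ) → ℝ}
    (hp : IsProper ℓ) {P : X × Y → ℝ} (hP : IsPMF P) {h : X → Y → ℝ}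
    (hh : ∀ x, h x ∈ simplex Y) : CE P h ℓ ≤ risk P h ℓ - BayesRF P ℓ := by
  set e : X → ℝ := fun x =>
    ∑ y, P (x, y) * ℓ y (h x) - margX P x * genEnt ℓ (condY P x) with he
  have hsum : risk P h ℓ - BayesRF P ℓ =
      ∑ ν ∈ univ.image h, ∑ x ∈ univ.filter (fun x => h x = ν), e x := by
    rw [sum_fiberwise_of_maps_to fun x hx => mem_image_of_mem h hx, BayesRF_eq_sum ℓ hP, risk,
      Fintype.sum_prod_type, ← sum_sub_distrib]
  rw [hsum, CE]
  refine (sum_le_sum fun ν hν => ?_).trans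
    (sum_le_sum_of_subset_of_nonneg (filter_subset _ _) fun ν _ _ => sum_nonneg fun x _ =>
      sub_nonneg.2 (margX_mul_genEnt_le hp hP x (hh x)))
  have hw : 0 < weight P h ν := (mem_filter.1 hν).2
  have hc := condOut_mem_simplex hP hw
  rw [breg, genEnt_eq_expLoss_self hp hc, mul_sub, weight_mul_expLoss_condOut ℓ hw,
    weight_mul_expLoss_condOut ℓ hw, ← sum_sub_distrib]
  refine sum_le_sum fun x hx => ?_
  simp only [he, (mem_filter.1 hx).2]
  exact sub_le_sub_left (margX_mul_genEnt_le hp hP x hc) _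

/-- The Bayes predictor attains the Bayes refinement. -/
theorem risk_condY_eq_BayesRF [Fintype X] [Fintype Y] {ℓ : Y → (Y → ℝ) → ℝ}
    (hp : IsProper ℓ) {P : X × Y → ℝ} (hP : IsPMF P) (hpos : ∀ x, 0 < margX P x) :
    risk P (fun x => condY P x) ℓ = BayesRF P ℓ := by
  rw [BayesRF_eq_sum ℓ hP, risk, Fintype.sum_prod_type]
  refine sum_congr rfl fun x _ => ?_
  rw [genEnt_eq_expLoss_self hp (condY_mem_simplex hP (hpos x)),
    margX_mul_expLoss_condY ℓ (hpos x)]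

/-- calibration error bound: under the saddle-point inequality, the
calibration error of `h* = Q*(·|·)` on `Q` is bounded by the difference of expected
generalized entropies, `CE_Q(h*,ℓ) ≤ B_{Q*}(ℓ) − B_Q(ℓ)`. -/
theorem mdl_calibration_error_bound
    [Fintype X] [Fintype Y] [Nonempty X] [Nonempty Y]
    (ℓ : Y → (Y → ℝ) → ℝ) (M : ℝ) (hb : IsBoundedLoss ℓ M) (hp : IsProper ℓ)
    (Q Qs : X × Y → ℝ) (hQ : IsPMF Q) (hQs : IsPMF Qs)
    (hpos : ∀ x, 0 < margX Qs x)
    (hsaddle : risk Q (fun x => condY Qs x) ℓ ≤ risk Qs (fun x => condY Qs x) ℓ) :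
    CE Q (fun x => condY Qs x) ℓ ≤ BayesRF Qs ℓ - BayesRF Q ℓ := by
  have hCE := CE_le_risk_sub_BayesRF hp hQ fun x => condY_mem_simplex hQs (hpos x)
  have hR := risk_condY_eq_BayesRF hp hQs hpos
  linarith

end
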